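/- Let f : ℝ × ℝ^N → ℝ^N be Lipschitz Carathéodory and satisfy: (H1) there are locally integrable α, β : ℝ → ℝ with β(t) ≥ 0 such that 2⟨f(t,x), x⟩ ≤ α(t)|x|² + β(t) for Lebesgue-a.e. (t,x) ∈ ℝ^{1+N}; (H2) there are constants α₁ > 0 and K ≥ 1 such that exp(∫_s^t α(u) du) ≤ K e^{−α₁(t−s)} for all s ≤ t ≤ 0; (H3) c₁ := sup_{t ∈ ℝ} ∫_t^{t+1} β(u) du < ∞. (Under (H1), every solution of ẋ = f(t,x) is defined forward in time on a half-line.) Then the process induced by f is strongly pullback bounded dissipative on (−∞, τ] for every τ ∈ ℝ: there exists a nondecreasing function ρ : ℝ → (0,∞) such that for every τ ∈ ℝ and every d > 0 there is T(τ, d) > 0 with |x(t, f, t−s, x₀)| ≤ ρ(τ) whenever t ≤ τ, s ≥ T(τ, d), and |x₀| ≤ d. -/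

import Mathlib

open MeasureTheory Set Filter Topology
open scoped RealInnerProductSpace

noncomputable section

abbrev Euc (n : ℕ) := EuclideanSpace ℝ (Fin n)

/-- A function `ℝ → ℝ` is locally integrable (w.r.t. Lebesgue measure) on every
compact interval. -/
def LocInt (m : ℝ → ℝ) : Prop := ∀ a b : ℝ, IntegrableOn m (Icc a b)

section Defs

variable {N : ℕ} {F : Type*} [NormedAddCommGroup F] [NormedSpace ℝ F]

/-- The Carathéodory conditions (C1) and (C2). -/
def IsCara (f : ℝ → Euc N → F) : Prop :=
  StronglyMeasurable (Function.uncurry f) ∧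
  ∀ K : Set (Euc N), IsCompact K → ∃ m : ℝ → ℝ, (∀ t, 0 ≤ m t) ∧ LocInt m ∧
    ∀ᵐ t : ℝ, ∀ x ∈ K, ‖f t x‖ ≤ m t

/-- A suitable set of moduli of continuity `Θ = {θ_j^{[q₁,q₂]}}`. -/
structure SuitableModuli where
  θ : ℕ → ℚ → ℚ → ℝ → ℝ
  nonneg : ∀ j q₁ q₂ s, (0:ℝ) ≤ s → 0 ≤ θ j q₁ q₂ s
  cont : ∀ j q₁ q₂, ContinuousOn (θ j q₁ q₂) (Ici 0)
  mono : ∀ j q₁ q₂, MonotoneOn (θ j q₁ q₂) (Ici 0)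
  zero : ∀ j q₁ q₂, θ j q₁ q₂ 0 = 0
  ordered : ∀ j₁ j₂ q₁ q₂ p₁ p₂, j₁ ≤ j₂ → p₁ ≤ q₁ → q₂ ≤ p₂ →
    ∀ s : ℝ, 0 ≤ s → θ j₁ q₁ q₂ s ≤ θ j₂ p₁ p₂ s

/-- `x ∈ K_j^{[q₁,q₂]}`: continuous, bounded by `j` and with modulus of continuity
`θ_j^{[q₁,q₂]}` on `[q₁,q₂]`. -/
def inK {N : ℕ} (Θ : SuitableModuli) (j : ℕ) (q₁ q₂ : ℚ) (x : ℝ → Euc N) : Prop :=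
  ContinuousOn x (Icc (q₁:ℝ) (q₂:ℝ)) ∧
  (∀ t ∈ Icc (q₁:ℝ) (q₂:ℝ), ‖x t‖ ≤ (j:ℝ)) ∧
  ∀ t ∈ Icc (q₁:ℝ) (q₂:ℝ), ∀ s ∈ Icc (q₁:ℝ) (q₂:ℝ), ‖x t - x s‖ ≤ Θ.θ j q₁ q₂ |t - s|

/-- Weak Θ-Carathéodory functions: Carathéodory conditions plus condition (W). -/
def IsWTC (Θ : SuitableModuli) (f : ℝ → Euc N → F) : Prop :=
  IsCara f ∧
  ∀ (j : ℕ) (q₁ q₂ : ℚ) (xs : ℕ → ℝ → Euc N) (x : ℝ → Euc N),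
    (∀ n, inK Θ j q₁ q₂ (xs n)) → inK Θ j q₁ q₂ x →
    TendstoUniformlyOn (fun n t => xs n t) x atTop (Icc (q₁:ℝ) (q₂:ℝ)) →
    Tendsto (fun n => ∫ t in Icc (q₁:ℝ) (q₂:ℝ), f t (xs n t)) atTop
      (𝓝 (∫ t in Icc (q₁:ℝ) (q₂:ℝ), f t (x t)))

/-- Convergence in the `σ_Θ` sense:
`sup_{x ∈ K_j^I} ‖∫_I (f_n(t,x(t)) − f(t,x(t))) dt‖ → 0` for every `j` and `I`. -/
def SigmaTendsto (Θ : SuitableModuli) (fs : ℕ → ℝ → Euc N → F) (f : ℝ → Euc N → F) : Prop :=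
  ∀ (j : ℕ) (q₁ q₂ : ℚ), ∀ ε > (0:ℝ), ∀ᶠ n in atTop, ∀ x : ℝ → Euc N, inK Θ j q₁ q₂ x →
    ‖∫ t in Icc (q₁:ℝ) (q₂:ℝ), (fs n t (x t) - f t (x t))‖ < ε

end Defs

/-- Lipschitz Carathéodory functions. -/
def IsLC {N : ℕ} (f : ℝ → Euc N → Euc N) : Prop :=
  IsCara f ∧
  ∀ K : Set (Euc N), IsCompact K → ∃ l : ℝ → ℝ, LocInt l ∧
    ∀ᵐ t : ℝ, ∀ x ∈ K, ∀ y ∈ K, ‖f t x - f t y‖ ≤ l t * ‖x - y‖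

/-- The optimal m-bound of `f` on the closed ball `B_j`. -/
def mOpt {N : ℕ} (f : ℝ → Euc N → Euc N) (j : ℕ) (t : ℝ) : ℝ :=
  sSup {v : ℝ | ∃ x : Euc N, ‖x‖ ≤ (j:ℝ) ∧ v = ‖f t x‖}

/-- The time translation `f_r(s,x) = f(s+r,x)`. -/
def timeTranslate {N : ℕ} (f : ℝ → Euc N → Euc N) (r : ℝ) : ℝ → Euc N → Euc N :=
  fun s x => f (s + r) x

/-- `x` is a solution of `ẋ = g(t,x)`, `x(0) = x₀`, defined on `[0,∞)`. -/
def IsSolOn {N : ℕ} (g : ℝ → Euc N → Euc N) (x₀ : Euc N) (x : ℝ → Euc N) : Prop :=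
  ContinuousOn x (Ici 0) ∧ ∀ t ∈ Ici (0:ℝ), x t = x₀ + ∫ s in (0:ℝ)..t, g s (x s)

theorem LocInt.intervalIntegrable {m : ℝ → ℝ} (hm : LocInt m) (a b : ℝ) :
    IntervalIntegrable m volume a b :=
  IntegrableOn.intervalIntegrable (hm _ _)

/-- A function whose increments are dominated by those of an absolutely continuous function is
absolutely continuous. -/
theorem AbsolutelyContinuousOnInterval.of_dist_le {X Y : Type*} [PseudoMetricSpace X]
    [PseudoMetricSpace Y] {f : ℝ → X} {g : ℝ → Y} {a b C : ℝ}
    (hg : AbsolutelyContinuousOnInterval g a b)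
    (h : ∀ u ∈ uIcc a b, ∀ v ∈ uIcc a b, dist (f u) (f v) ≤ C * dist (g u) (g v)) :
    AbsolutelyContinuousOnInterval f a b := by
  unfold AbsolutelyContinuousOnInterval at hg ⊢
  refine squeeze_zero' (Eventually.of_forall fun E => Finset.sum_nonneg fun i _ => dist_nonneg) ?_
    (by simpa using hg.const_mul C)
  filter_upwards [mem_inf_of_right (mem_principal_self _)] with E hE
  rw [Finset.mul_sum]
  exact Finset.sum_le_sum fun i hi => h _ (hE.1 i hi).1 _ (hE.1 i hi).2

/-- The exponential of an absolutely continuous function is absolutely continuous. -/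
theorem AbsolutelyContinuousOnInterval.exp {g : ℝ → ℝ} {a b : ℝ}
    (hg : AbsolutelyContinuousOnInterval g a b) :
    AbsolutelyContinuousOnInterval (fun u => Real.exp (g u)) a b := by
  obtain ⟨R, hR⟩ := hg.exists_bound
  obtain ⟨L, hL⟩ := (Real.contDiff_exp (n := 1)).contDiffOn.exists_lipschitzOnWith
    (by decide) (convex_Icc (-R) R) isCompact_Icc
  exact hg.of_dist_le (C := L) fun u hu v hv =>
    hL.dist_le_mul _ (abs_le.1 (hR u hu)) _ (abs_le.1 (hR v hv))

/-- Gronwall's inequality for absolutely continuous functions. -/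
theorem AbsolutelyContinuousOnInterval.le_exp_mul_add_integral {α β y : ℝ → ℝ} {a b : ℝ}
    (hab : a ≤ b) (hα : IntervalIntegrable α volume a b) (hβ : IntervalIntegrable β volume a b)
    (hy : AbsolutelyContinuousOnInterval y a b)
    (h : ∀ᵐ u, u ∈ Icc a b → deriv y u ≤ α u * y u + β u) :
    y b ≤ Real.exp (∫ v in a..b, α v) * y a +
      ∫ u in a..b, Real.exp (∫ v in u..b, α v) * β u := by
  have hA : AbsolutelyContinuousOnInterval (fun u => ∫ v in u..b, α v) a b := by
    simp_rw [fun u => intervalIntegral.integral_symm (μ := volume) (f := α) b u]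
    exact (hα.absolutelyContinuousOnInterval_intervalIntegral (by simp)).neg
  have hE := hA.exp
  have hz := hE.fun_mul hy
  have key := hz.integral_deriv_eq_sub
  have hint : IntervalIntegrable (fun u => Real.exp (∫ v in u..b, α v) * β u) volume a b :=
    hβ.continuousOn_mul hE.continuousOn
  have hmono := intervalIntegral.integral_mono_ae_restrict hab hz.intervalIntegrable_deriv hint <| by
    refine (ae_restrict_iff' measurableSet_Icc).2 ?_
    filter_upwards [h, hα.ae_hasDerivAt_integral, hy.ae_differentiableAt] with u h1 h2 h3 hu
    have hu' : u ∈ uIcc a b := by rwa [uIcc_of_le hab]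
    have hd : HasDerivAt (fun u => ∫ v in u..b, α v) (-α u) u := by
      simp_rw [fun u => intervalIntegral.integral_symm (μ := volume) (f := α) b u]
      exact (h2 hu' b (by simp)).neg
    have hd' := hd.exp.mul (h3 hu').hasDerivAt
    have e : deriv (fun u => Real.exp (∫ v in u..b, α v) * y u) u = _ := hd'.deriv
    rw [e]
    nlinarith [mul_le_mul_of_nonneg_left (h1 hu) (Real.exp_pos (∫ v in u..b, α v)).le]
  rw [key] at hmono
  simp only [intervalIntegral.integral_same, Real.exp_zero, one_mul] at hmono
  linarith

/-- The squared norm of a primitive of an integrable function is absolutely continuous. -/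
theorem IntervalIntegrable.absolutelyContinuousOnInterval_norm_sq {E : Type*}
    [NormedAddCommGroup E] [InnerProductSpace ℝ E] [CompleteSpace E] {F : ℝ → E} {a b : ℝ}
    (hF : IntervalIntegrable F volume a b) (x₀ : E) :
    AbsolutelyContinuousOnInterval (fun u => ‖x₀ + ∫ v in a..u, F v‖ ^ 2) a b := by
  have hG := hF.norm.absolutelyContinuousOnInterval_intervalIntegral (c := a) (by simp)
  have hX : AbsolutelyContinuousOnInterval (fun u => x₀ + ∫ v in a..u, F v) a b := by
    refine hG.of_dist_le (C := 1) fun u hu v hv => ?_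
    have h1 : ∀ w ∈ uIcc a b, IntervalIntegrable F volume a w := fun w hw =>
      hF.mono_set (uIcc_subset_uIcc left_mem_uIcc hw)
    rw [dist_add_left, dist_eq_norm, Real.dist_eq, one_mul,
      intervalIntegral.integral_interval_sub_left (h1 u hu) (h1 v hv),
      intervalIntegral.integral_interval_sub_left (h1 u hu).norm (h1 v hv).norm]
    exact intervalIntegral.norm_integral_le_abs_integral_norm
  have hN : AbsolutelyContinuousOnInterval (fun u => ‖x₀ + ∫ v in a..u, F v‖) a b :=
    hX.of_dist_le (C := 1) fun u _ v _ => by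
      rw [one_mul, dist_eq_norm (x₀ + _)]
      exact abs_norm_sub_norm_le _ _
  simpa [pow_two] using hN.fun_mul hN

/-- A one-sided growth bound which holds almost everywhere holds, for almost every time, at every
point of the phase space. -/
theorem IsLC.ae_forall_inner_le {N : ℕ} {f : ℝ → Euc N → Euc N} (hf : IsLC f) {α β : ℝ → ℝ}
    (h : ∀ᵐ p : ℝ × Euc N, 2 * ⟪f p.1 p.2, p.2⟫ ≤ α p.1 * ‖p.2‖ ^ 2 + β p.1) :
    ∀ᵐ t : ℝ, ∀ x : Euc N, 2 * ⟪f t x, x⟫ ≤ α t * ‖x‖ ^ 2 + β t := by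
  have hL : ∀ᵐ t : ℝ, ∀ n : ℕ, ContinuousOn (f t) (Metric.closedBall 0 n) := by
    rw [ae_all_iff]
    intro n
    obtain ⟨l, -, hl⟩ := hf.2 _ (isCompact_closedBall (0 : Euc N) n)
    filter_upwards [hl] with t ht
    refine LipschitzOnWith.continuousOn (K := (l t).toNNReal)
      (LipschitzOnWith.of_dist_le_mul fun x hx y hy => ?_)
    rw [dist_eq_norm, dist_eq_norm]
    exact (ht x hx y hy).trans
      (mul_le_mul_of_nonneg_right (Real.le_coe_toNNReal _) (norm_nonneg _))
  rw [Measure.volume_eq_prod] at h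
  filter_upwards [hL, Measure.ae_ae_of_ae_prod h] with t ht hae
  have hc : Continuous (f t) := by
    refine continuous_iff_continuousAt.2 fun x => ?_
    obtain ⟨n, hn⟩ := exists_nat_gt ‖x‖
    exact (ht n).continuousAt (Metric.closedBall_mem_nhds_of_mem (by simpa using hn))
  have hcl : IsClosed {x : Euc N | 2 * ⟪f t x, x⟫ ≤ α t * ‖x‖ ^ 2 + β t} :=
    isClosed_le (by fun_prop) (by fun_prop)
  have hd := Measure.dense_of_ae hae
  intro x
  exact hcl.closure_eq.subset (hd x)

/-- A Carathéodory function is integrable along continuous curves. -/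
theorem IsCara.intervalIntegrable_comp {N : ℕ} {f : ℝ → Euc N → Euc N} (hf : IsCara f)
    {x : ℝ → Euc N} {a b : ℝ} (hab : a ≤ b) (hx : ContinuousOn x (Icc a b)) :
    IntervalIntegrable (fun v => f v (x v)) volume a b := by
  obtain ⟨m, -, hm, hle⟩ := hf.2 _ (isCompact_Icc.image_of_continuousOn hx)
  rw [intervalIntegrable_iff_integrableOn_Icc_of_le hab]
  refine Integrable.mono' (hm a b) ?_ ?_
  · exact (hf.1.measurable.comp_aemeasurable
      (aemeasurable_id.prodMk (hx.aemeasurable measurableSet_Icc))).aestronglyMeasurable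
  · refine (ae_restrict_iff' measurableSet_Icc).2 ?_
    filter_upwards [hle] with v hv hmem
    exact hv _ (mem_image_of_mem x hmem)

/-- The energy estimate for solutions under a one-sided growth bound. -/
theorem IsLC.norm_sq_le {N : ℕ} {f : ℝ → Euc N → Euc N} (hf : IsLC f) {α β : ℝ → ℝ}
    (hα : LocInt α) (hβ : LocInt β)
    (h : ∀ᵐ p : ℝ × Euc N, 2 * ⟪f p.1 p.2, p.2⟫ ≤ α p.1 * ‖p.2‖ ^ 2 + β p.1)
    {a b : ℝ} (hab : a ≤ b) {x₀ : Euc N} {x : ℝ → Euc N} (hx : ContinuousOn x (Icc a b))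
    (hsol : ∀ u ∈ Icc a b, x u = x₀ + ∫ v in a..u, f v (x v)) :
    ‖x b‖ ^ 2 ≤ Real.exp (∫ v in a..b, α v) * ‖x₀‖ ^ 2 +
      ∫ u in a..b, Real.exp (∫ v in u..b, α v) * β u := by
  have hF := hf.1.intervalIntegrable_comp hab hx
  have := (hF.absolutelyContinuousOnInterval_norm_sq x₀).le_exp_mul_add_integral hab
    (hα.intervalIntegrable a b) (hβ.intervalIntegrable a b) <| by
      filter_upwards [hf.ae_forall_inner_le h, hF.ae_hasDerivAt_integral] with u h1 h2 hu
      have hd := ((h2 (by rwa [uIcc_of_le hab]) a (by simp)).const_add x₀).norm_sq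
      rw [hd.deriv, ← hsol u hu, real_inner_comm]
      exact h1 (x u)
  simpa [← hsol b (right_mem_Icc.2 hab)] using this

/-- A nonnegative function with uniformly bounded integrals over unit intervals has uniformly
bounded exponentially weighted integrals. -/
theorem integral_exp_mul_le {β : ℝ → ℝ} (hβ : LocInt β) (hβ0 : ∀ t, 0 ≤ β t) {c κ : ℝ}
    (hκ : 0 < κ) (hc : ∀ t : ℝ, ∫ u in t..(t + 1), β u ≤ c) {a t : ℝ} (hat : a ≤ t) :
    ∫ u in a..t, Real.exp (-κ * (t - u)) * β u ≤ c / (1 - Real.exp (-κ)) := by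
  have hq : 0 < 1 - Real.exp (-κ) := by
    have := Real.exp_lt_one_iff.2 (neg_lt_zero.2 hκ)
    linarith
  have hc0 : 0 ≤ c :=
    (intervalIntegral.integral_nonneg (by norm_num) fun u _ => hβ0 u).trans (hc 0)
  have hint : ∀ t a b : ℝ,
      IntervalIntegrable (fun u => Real.exp (-κ * (t - u)) * β u) volume a b := fun t a b =>
    (hβ.intervalIntegrable a b).continuousOn_mul (by fun_prop)
  have hn : ∀ n : ℕ, ∀ t : ℝ,
      ∫ u in (t - n)..t, Real.exp (-κ * (t - u)) * β u ≤ c / (1 - Real.exp (-κ)) := by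
    intro n
    induction n with
    | zero => intro t; simpa using div_nonneg hc0 hq.le
    | succ n ih =>
      intro t
      have h1 : ∫ u in (t - 1)..t, Real.exp (-κ * (t - u)) * β u ≤ c := by
        refine le_trans ?_ (by simpa using hc (t - 1))
        refine intervalIntegral.integral_mono_on (by linarith) (hint _ _ _)
          (hβ.intervalIntegrable _ _) fun u hu => ?_
        refine mul_le_of_le_one_left (hβ0 u) (Real.exp_le_one_iff.2 ?_)
        nlinarith [hu.2]
      have h2 : ∫ u in (t - (n + 1 : ℕ))..(t - 1), Real.exp (-κ * (t - u)) * β u =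
          Real.exp (-κ) * ∫ u in (t - 1 - n)..(t - 1), Real.exp (-κ * (t - 1 - u)) * β u := by
        rw [← intervalIntegral.integral_const_mul]
        have : t - ((n + 1 : ℕ) : ℝ) = t - 1 - n := by push_cast; ring
        rw [this]
        congr 1
        ext u
        rw [← mul_assoc, ← Real.exp_add]
        ring_nf
      rw [← intervalIntegral.integral_add_adjacent_intervals (hint t _ (t - 1)) (hint t _ _), h2]
      have h3 := mul_le_mul_of_nonneg_left (ih (t - 1)) (Real.exp_pos (-κ)).le
      have h4 : Real.exp (-κ) * (c / (1 - Real.exp (-κ))) + c = c / (1 - Real.exp (-κ)) := by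
        field_simp
        ring
      linarith
  obtain ⟨n, hna⟩ := exists_nat_ge (t - a)
  refine le_trans ?_ (hn n t)
  refine intervalIntegral.integral_mono_interval (by linarith) hat le_rfl
    (Eventually.of_forall fun u => mul_nonneg (Real.exp_pos _).le (hβ0 u)) (hint _ _ _)

/-- Integrals over subintervals are bounded by the integral of the absolute value. -/
theorem LocInt.integral_le_integral_abs {m : ℝ → ℝ} (hm : LocInt m) {a b p q : ℝ}
    (hpa : p ≤ a) (hab : a ≤ b) (hbq : b ≤ q) : ∫ u in a..b, m u ≤ ∫ u in p..q, |m u| :=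
  (intervalIntegral.integral_mono_on hab (hm.intervalIntegrable _ _)
    (hm.intervalIntegrable _ _).abs fun _ _ => le_abs_self _).trans
  (intervalIntegral.integral_mono_interval hpa hab hbq
    (Eventually.of_forall fun _ => abs_nonneg _) (hm.intervalIntegrable _ _).abs)

/-- Exponential decay of `exp (∫ α)` on the negative half-line extends, up to a constant, to every
half-line `(-∞, p]`. -/
theorem exp_integral_le_of_nonpos {α : ℝ → ℝ} (hα : LocInt α) {K κ : ℝ} (hK : 1 ≤ K)
    (h : ∀ s t : ℝ, s ≤ t → t ≤ 0 →
      Real.exp (∫ u in s..t, α u) ≤ K * Real.exp (-κ * (t - s)))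
    {s t p : ℝ} (hst : s ≤ t) (htp : t ≤ p) (hp : 0 ≤ p) :
    Real.exp (∫ u in s..t, α u) ≤
      K * Real.exp (∫ u in (0 : ℝ)..p, |α u + κ|) * Real.exp (-κ * (t - s)) := by
  have hγ : LocInt fun u => α u + κ := fun a b => (hα a b).add (by simp)
  have hsplit : ∀ a b : ℝ, ∫ u in a..b, α u = (∫ u in a..b, (α u + κ)) + -κ * (b - a) := by
    intro a b
    rw [intervalIntegral.integral_add (hα.intervalIntegrable a b) (by simp)]
    simp
    ring
  have hlow : ∀ a b : ℝ, a ≤ b → b ≤ 0 → Real.exp (∫ u in a..b, (α u + κ)) ≤ K := by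
    intro a b hab hb
    have := h a b hab hb
    rw [hsplit, Real.exp_add] at this
    exact le_of_mul_le_mul_right this (Real.exp_pos _)
  have hM : 0 ≤ ∫ u in (0 : ℝ)..p, |α u + κ| :=
    intervalIntegral.integral_nonneg hp fun _ _ => abs_nonneg _
  rw [hsplit, Real.exp_add]
  refine mul_le_mul_of_nonneg_right ?_ (Real.exp_pos _).le
  rcases le_total t 0 with ht | ht
  · exact (hlow s t hst ht).trans (le_mul_of_one_le_right (by linarith) (Real.one_le_exp hM))
  rcases le_total s 0 with hs | hs
  · rw [← intervalIntegral.integral_add_adjacent_intervals (hγ.intervalIntegrable s 0)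
      (hγ.intervalIntegrable 0 t), Real.exp_add]
    exact mul_le_mul (hlow s 0 hs le_rfl)
      (Real.exp_le_exp.2 (hγ.integral_le_integral_abs le_rfl ht htp)) (Real.exp_pos _).le
      (by linarith)
  · exact (Real.exp_le_exp.2 (hγ.integral_le_integral_abs hs hst htp)).trans
      (le_mul_of_one_le_left (Real.exp_pos _).le hK)

/-- under (H1), (H2) and (H3), the process induced by `f` is strongly
pullback bounded dissipative on `(−∞,τ]` for every `τ`. -/
theorem stmt16 {N : ℕ} (f : ℝ → Euc N → Euc N) (hf : IsLC f)
    (α β : ℝ → ℝ) (hα : LocInt α) (hβ : LocInt β) (hβ0 : ∀ t, 0 ≤ β t)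
    (hH1 : ∀ᵐ p : ℝ × Euc N, 2 * ⟪f p.1 p.2, p.2⟫ ≤ α p.1 * ‖p.2‖ ^ 2 + β p.1)
    (K α₁ : ℝ) (hK : 1 ≤ K) (hα₁ : 0 < α₁)
    (hH2 : ∀ s t : ℝ, s ≤ t → t ≤ 0 →
      Real.exp (∫ u in s..t, α u) ≤ K * Real.exp (-α₁ * (t - s)))
    (c₁ : ℝ) (hH3 : ∀ t : ℝ, ∫ u in t..(t + 1), β u ≤ c₁) :
    ∃ ρ : ℝ → ℝ, Monotone ρ ∧ (∀ τ, 0 < ρ τ) ∧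
      ∀ τ : ℝ, ∀ d > (0:ℝ), ∃ T > (0:ℝ), ∀ t s : ℝ, t ≤ τ → T ≤ s →
        ∀ x₀ : Euc N, ‖x₀‖ ≤ d → ∀ x : ℝ → Euc N,
          ContinuousOn x (Icc (t - s) t) →
          (∀ u ∈ Icc (t - s) t, x u = x₀ + ∫ v in (t - s)..u, f v (x v)) →
          ‖x t‖ ≤ ρ τ := by
  have hγ : LocInt fun u => α u + α₁ := fun a b => (hα a b).add (by simp)
  set C := c₁ / (1 - Real.exp (-α₁))
  have hC : 0 ≤ C := by
    simpa using integral_exp_mul_le hβ hβ0 hα₁ hH3 (le_refl (0 : ℝ))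
  set M : ℝ → ℝ := fun τ => Real.exp (∫ u in (0 : ℝ)..(max τ 0), |α u + α₁|)
  have hM : ∀ τ, 1 ≤ M τ := fun τ => Real.one_le_exp
    (intervalIntegral.integral_nonneg (le_max_right _ _) fun _ _ => abs_nonneg _)
  have hKM : ∀ τ, 1 ≤ K * M τ := fun τ => one_le_mul_of_one_le_of_one_le hK (hM τ)
  have hρ : ∀ τ, 1 ≤ K * M τ * (1 + C) := fun τ =>
    one_le_mul_of_one_le_of_one_le (hKM τ) (by linarith)
  refine ⟨fun τ => K * M τ * (1 + C), ?_, fun τ => by linarith [hρ τ], ?_⟩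
  · intro τ₁ τ₂ hτ
    have : M τ₁ ≤ M τ₂ := Real.exp_le_exp.2 <|
      intervalIntegral.integral_mono_interval le_rfl (le_max_right _ _) (max_le_max_right 0 hτ)
        (Eventually.of_forall fun _ => abs_nonneg _) (hγ.intervalIntegrable _ _).abs
    exact mul_le_mul_of_nonneg_right (mul_le_mul_of_nonneg_left this (by linarith)) (by linarith)
  intro τ d hd
  refine ⟨d ^ 2 / α₁, by positivity, fun t s ht hs x₀ hx₀ x hx hsol => ?_⟩
  have hs0 : 0 ≤ s := le_trans (by positivity) hs
  have hts : t - s ≤ t := by linarith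
  have hexp : ∀ u ≤ t, Real.exp (∫ v in u..t, α v) ≤ K * M τ * Real.exp (-α₁ * (t - u)) :=
    fun u hu => exp_integral_le_of_nonpos hα hK hH2 hu (ht.trans (le_max_left _ _))
      (le_max_right _ _)
  have henergy := hf.norm_sq_le hα hβ hH1 hts hx hsol
  have hinit : Real.exp (∫ v in (t - s)..t, α v) * ‖x₀‖ ^ 2 ≤ K * M τ := by
    have h1 : ‖x₀‖ ^ 2 ≤ d ^ 2 := pow_le_pow_left₀ (norm_nonneg _) hx₀ 2
    have h2 : d ^ 2 ≤ Real.exp (α₁ * s) := by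
      have := (div_le_iff₀ hα₁).1 hs
      linarith [Real.add_one_le_exp (α₁ * s)]
    have h3 : Real.exp (-α₁ * (t - (t - s))) * ‖x₀‖ ^ 2 ≤ 1 := by
      calc _ ≤ Real.exp (-α₁ * (t - (t - s))) * Real.exp (α₁ * s) :=
            mul_le_mul_of_nonneg_left (h1.trans h2) (Real.exp_pos _).le
        _ = 1 := by
            rw [← Real.exp_add, Real.exp_eq_one_iff]
            ring
    calc _ ≤ K * M τ * Real.exp (-α₁ * (t - (t - s))) * ‖x₀‖ ^ 2 :=
          mul_le_mul_of_nonneg_right (hexp _ hts) (by positivity)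
      _ = K * M τ * (Real.exp (-α₁ * (t - (t - s))) * ‖x₀‖ ^ 2) := by ring
      _ ≤ K * M τ := mul_le_of_le_one_right (by linarith [hKM τ]) h3
  have hforce : ∫ u in (t - s)..t, Real.exp (∫ v in u..t, α v) * β u ≤ K * M τ * C := by
    have hcont : ContinuousOn (fun u => Real.exp (∫ v in u..t, α v)) (uIcc (t - s) t) := by
      simp_rw [fun u => intervalIntegral.integral_symm (μ := volume) (f := α) t u]
      exact (((hα.intervalIntegrable _ _).absolutelyContinuousOnInterval_intervalIntegral
        (by simp)).continuousOn.neg).rexp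
    calc _ ≤ ∫ u in (t - s)..t, K * M τ * (Real.exp (-α₁ * (t - u)) * β u) := by
          refine intervalIntegral.integral_mono_on hts
            ((hβ.intervalIntegrable _ _).continuousOn_mul hcont)
            (((hβ.intervalIntegrable _ _).continuousOn_mul (by fun_prop)).const_mul _)
            fun u hu => ?_
          rw [← mul_assoc]
          exact mul_le_mul_of_nonneg_right (hexp u hu.2) (hβ0 u)
      _ ≤ K * M τ * C := by
          rw [intervalIntegral.integral_const_mul]
          exact mul_le_mul_of_nonneg_left (integral_exp_mul_le hβ hβ0 hα₁ hH3 hts)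
            (by linarith [hKM τ])
  have hsq : ‖x t‖ ^ 2 ≤ K * M τ * (1 + C) := by linarith
  nlinarith [hρ τ, norm_nonneg (x t)]
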